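/- Let ξ ~ N((β π', π')', Σ) in ℝ^{2k} with each π_i > 0, let ζ ~ N(0,Σ) independent of ξ, ξ^{(a)} = ξ + ζ, ξ^{(b)} = ξ − ζ. Let ŵ(ξ^{(b)}) ∈ ℝ^k be any bounded measurable weight function with Σ_i ŵ_i = 1, and let β̂_U(ξ^{(a)}(i), 2Σ(i)) be the single-instrument unbiased estimator based on the i-th coordinates of ξ^{(a)}. Then E[Σ_{i=1}^k ŵ_i(ξ^{(b)})·β̂_U(ξ^{(a)}(i), 2Σ(i))] = β. -/

import Mathlib

open MeasureTheory ProbabilityTheory Filter Matrix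

/-- Standard normal density `φ`. -/
noncomputable def stdPDF (x : ℝ) : ℝ :=
  (Real.sqrt (2 * Real.pi))⁻¹ * Real.exp (-(x ^ 2) / 2)

/-- Standard normal CDF `Φ`. -/
noncomputable def stdCDF (x : ℝ) : ℝ := ∫ t in Set.Iic x, stdPDF t

/-- Mills-ratio estimator `τ̂(x, σ²) = (1/σ)(1 − Φ(x/σ))/φ(x/σ)`. -/
noncomputable def millsTau (σ x : ℝ) : ℝ :=
  (1 / σ) * (1 - stdCDF (x / σ)) / stdPDF (x / σ)

/-- The multivariate normal distribution N(μ, AAᵀ) on ι → ℝ. -/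
noncomputable def mvGaussian {ι : Type*} [Fintype ι] (μ : ι → ℝ)
    (A : Matrix ι ι ℝ) : Measure (ι → ℝ) :=
  (Measure.pi fun _ : ι => gaussianReal 0 1).map (fun z => μ + A.mulVec z)

/-- Single-instrument unbiased estimator β̂_U(x, Ω) with covariance entries s₁₂, s₂₂. -/
noncomputable def betaU (x₁ x₂ s₁₂ s₂₂ : ℝ) : ℝ :=
  millsTau (Real.sqrt s₂₂) x₂ * (x₁ - (s₁₂ / s₂₂) * x₂) + s₁₂ / s₂₂

lemma stdPDF_eq (x : ℝ) : stdPDF x = gaussianPDFReal 0 1 x := by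
  simp [stdPDF, gaussianPDFReal]

lemma stdPDF_pos (x : ℝ) : 0 < stdPDF x := by
  rw [stdPDF_eq]; exact gaussianPDFReal_pos _ _ _ one_ne_zero

lemma stdCDF_eq (x : ℝ) : stdCDF x = (gaussianReal 0 1).real (Set.Iic x) := by
  rw [measureReal_def, gaussianReal_apply_eq_integral _ one_ne_zero, ENNReal.toReal_ofReal]
  · simp only [stdCDF, stdPDF_eq]
  · exact integral_nonneg fun _ => gaussianPDFReal_nonneg _ _ _

lemma one_sub_stdCDF (x : ℝ) : 1 - stdCDF x = (gaussianReal 0 1).real (Set.Ioi x) := by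
  rw [stdCDF_eq, ← Set.compl_Iic, probReal_compl_eq_one_sub measurableSet_Iic]

lemma measurable_stdCDF : Measurable stdCDF := by
  apply Monotone.measurable
  intro x y h
  rw [stdCDF_eq, stdCDF_eq]
  exact measureReal_mono (Set.Iic_subset_Iic.2 h)

lemma measurable_millsTau (σ : ℝ) : Measurable (millsTau σ) := by
  have h1 : Measurable stdPDF := by unfold stdPDF; fun_prop
  have h2 := measurable_stdCDF
  unfold millsTau
  fun_prop

lemma millsTau_nonneg {σ : ℝ} (hσ : 0 < σ) (x : ℝ) : 0 ≤ millsTau σ x := by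
  unfold millsTau
  rw [one_sub_stdCDF]
  have := stdPDF_pos (x / σ)
  positivity

lemma lintegral_exp_Iio {a : ℝ} (ha : 0 < a) (t : ℝ) :
    ∫⁻ z in Set.Iio t, ENNReal.ofReal (Real.exp (a * z)) = ENNReal.ofReal (Real.exp (a * t) / a) := by
  rw [setLIntegral_congr Iio_ae_eq_Iic, ← ofReal_integral_eq_lintegral_ofReal
    (integrableOn_exp_mul_Iic ha t) (ae_of_all _ fun _ => (Real.exp_pos _).le),
    integral_exp_mul_Iic ha]

lemma lintegral_tail {a : ℝ} (ha : 0 < a) :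
    ∫⁻ z, ENNReal.ofReal (Real.exp (a * z)) * gaussianReal 0 1 (Set.Ioi z)
      = ENNReal.ofReal (Real.exp (a ^ 2 / 2) / a) := by
  have h1 : ∀ z : ℝ, ENNReal.ofReal (Real.exp (a * z)) * gaussianReal 0 1 (Set.Ioi z)
      = ∫⁻ t, {p : ℝ × ℝ | p.1 < p.2}.indicator
        (fun p => ENNReal.ofReal (Real.exp (a * p.1))) (z, t) ∂(gaussianReal 0 1) := by
    intro z
    rw [← lintegral_indicator_const measurableSet_Ioi]
    rfl
  simp_rw [h1]
  have hm : Measurable ({p : ℝ × ℝ | p.1 < p.2}.indicator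
        (fun p => ENNReal.ofReal (Real.exp (a * p.1)))) :=
    Measurable.indicator (by fun_prop) (measurableSet_lt measurable_fst measurable_snd)
  rw [lintegral_lintegral_swap (f := fun z t => {p : ℝ × ℝ | p.1 < p.2}.indicator
        (fun p => ENNReal.ofReal (Real.exp (a * p.1))) (z, t)) hm.aemeasurable]
  have h2 : ∀ t : ℝ, ∫⁻ z, {p : ℝ × ℝ | p.1 < p.2}.indicator
        (fun p => ENNReal.ofReal (Real.exp (a * p.1))) (z, t)
        = ENNReal.ofReal (Real.exp (a * t) / a) := by
    intro t
    rw [← lintegral_exp_Iio ha, ← lintegral_indicator measurableSet_Iio]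
    rfl
  simp_rw [h2]
  rw [← ofReal_integral_eq_lintegral_ofReal
    ((integrable_exp_mul_gaussianReal a).div_const a)
    (ae_of_all _ fun _ => by positivity), integral_div]
  have := congrFun (mgf_fun_id_gaussianReal (μ := 0) (v := 1)) a
  simp only [mgf] at this
  rw [this]
  simp

lemma lintegral_millsTau {σ m : ℝ} (hσ : 0 < σ) (hm : 0 < m) :
    ∫⁻ x, ENNReal.ofReal (millsTau σ x) ∂(gaussianReal m (σ ^ 2).toNNReal)
      = ENNReal.ofReal (1 / m) := by
  have hmap : gaussianReal m (σ ^ 2).toNNReal = (gaussianReal (m / σ) 1).map (σ * ·) := by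
    rw [gaussianReal_map_const_mul]
    congr 1
    · field_simp
    · rw [mul_one]; ext; simp; positivity
  have ha : 0 < m / σ := by positivity
  have hmeas : Measurable (fun z => ENNReal.ofReal (millsTau σ (σ * z))) :=
    ((measurable_millsTau σ).comp (by fun_prop : Measurable (σ * ·))).ennreal_ofReal
  rw [hmap, lintegral_map (measurable_millsTau σ).ennreal_ofReal (by fun_prop),
    gaussianReal_of_var_ne_zero _ one_ne_zero,
    lintegral_withDensity_eq_lintegral_mul _ (measurable_gaussianPDF _ _) hmeas]
  have : ∀ z : ℝ, (gaussianPDF (m / σ) 1 * fun z => ENNReal.ofReal (millsTau σ (σ * z))) z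
      = ENNReal.ofReal (Real.exp (-(m / σ) ^ 2 / 2) / σ) *
        (ENNReal.ofReal (Real.exp ((m / σ) * z)) * gaussianReal 0 1 (Set.Ioi z)) := by
    intro z
    rw [← ofReal_measureReal (μ := gaussianReal 0 1) (s := Set.Ioi z), ← one_sub_stdCDF,
      ← ENNReal.ofReal_mul (by positivity), ← ENNReal.ofReal_mul (by positivity),
      Pi.mul_apply, gaussianPDF, ← ENNReal.ofReal_mul (gaussianPDFReal_nonneg _ _ _)]
    congr 1
    have hz : σ * z / σ = z := by field_simp
    rw [millsTau, hz]
    have hp := stdPDF_pos z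
    have : gaussianPDFReal (m / σ) 1 z
        = stdPDF z * (Real.exp (-(m / σ) ^ 2 / 2) * Real.exp ((m / σ) * z)) := by
      simp only [gaussianPDFReal, stdPDF]
      simp only [NNReal.coe_one, mul_one]
      rw [← Real.exp_add, mul_assoc, ← Real.exp_add]
      congr 2
      ring
    rw [this]
    field_simp
  simp_rw [this]
  rw [lintegral_const_mul', lintegral_tail ha, ← ENNReal.ofReal_mul (by positivity)]
  · congr 1
    rw [div_mul_div_comm, ← Real.exp_add]
    have : -(m / σ) ^ 2 / 2 + (m / σ) ^ 2 / 2 = 0 := by ring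
    rw [this]
    simp
    field_simp
  · exact ENNReal.ofReal_ne_top

lemma integrable_millsTau {σ m : ℝ} (hσ : 0 < σ) (hm : 0 < m) :
    Integrable (millsTau σ) (gaussianReal m (σ ^ 2).toNNReal) := by
  refine ⟨(measurable_millsTau σ).aestronglyMeasurable, ?_⟩
  rw [hasFiniteIntegral_iff_ofReal (ae_of_all _ (millsTau_nonneg hσ)), lintegral_millsTau hσ hm]
  exact ENNReal.ofReal_lt_top

lemma integral_millsTau {σ m : ℝ} (hσ : 0 < σ) (hm : 0 < m) :
    ∫ x, millsTau σ x ∂(gaussianReal m (σ ^ 2).toNNReal) = 1 / m := by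
  rw [integral_eq_lintegral_of_nonneg_ae (ae_of_all _ (millsTau_nonneg hσ))
    (measurable_millsTau σ).aestronglyMeasurable, lintegral_millsTau hσ hm,
    ENNReal.toReal_ofReal (by positivity)]

lemma pi_hasGaussianLaw {ι : Type*} [Fintype ι] :
    HasGaussianLaw (fun z : ι → ℝ => z) (Measure.pi fun _ : ι => gaussianReal 0 1) := by
  have h := iIndepFun_pi (μ := fun _ : ι => gaussianReal 0 1) (X := fun _ => id)
    (fun _ => aemeasurable_id)
  refine iIndepFun.hasGaussianLaw (fun i => ?_) h
  refine ⟨?_⟩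
  have := (measurePreserving_eval (fun _ : ι => gaussianReal 0 1) i).map_eq
  change IsGaussian (Measure.map (Function.eval i) (Measure.pi fun _ : ι => gaussianReal 0 1))
  rw [this]; infer_instance

instance mvGaussian_isGaussian {ι : Type*} [Fintype ι] (μ : ι → ℝ) (A : Matrix ι ι ℝ) :
    IsGaussian (mvGaussian μ A) := by
  have h := pi_hasGaussianLaw (ι := ι)
  have h2 := (h.map_fun (LinearMap.toContinuousLinearMap (Matrix.mulVecLin A))).isGaussian_map
  have : mvGaussian μ A = ((Measure.pi fun _ : ι => gaussianReal 0 1).map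
      (fun z => LinearMap.toContinuousLinearMap (Matrix.mulVecLin A) z)).map (fun y => μ + y) := by
    rw [Measure.map_map (by fun_prop) (by fun_prop)]
    rfl
  rw [this]
  infer_instance

lemma pi_mean {ι : Type*} [Fintype ι] (i : ι) :
    ∫ z : ι → ℝ, z i ∂(Measure.pi fun _ : ι => gaussianReal 0 1) = 0 := by
  have := (measurePreserving_eval (fun _ : ι => gaussianReal 0 1) i)
  have h := integral_map (μ := Measure.pi fun _ : ι => gaussianReal 0 1)
    (φ := Function.eval i) (f := fun x : ℝ => x) (measurable_pi_apply i).aemeasurable (by fun_prop)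
  rw [this.map_eq, integral_id_gaussianReal] at h
  exact h.symm

lemma pi_cov {ι : Type*} [Fintype ι] [DecidableEq ι] (i j : ι) :
    cov[fun z : ι → ℝ => z i, fun z => z j; (Measure.pi fun _ : ι => gaussianReal 0 1)]
      = if i = j then 1 else 0 := by
  have hL : ∀ i, MemLp (fun z : ι → ℝ => z i) 2 (Measure.pi fun _ : ι => gaussianReal 0 1) :=
    fun i => (pi_hasGaussianLaw.eval i).memLp_two
  split_ifs with h
  · subst h
    rw [covariance_self (measurable_pi_apply i).aemeasurable]
    have := (measurePreserving_eval (fun _ : ι => gaussianReal 0 1) i)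
    have h2 := variance_map (X := fun x : ℝ => x) (μ := Measure.pi fun _ : ι => gaussianReal 0 1)
      (Y := Function.eval i) (by fun_prop) (measurable_pi_apply i).aemeasurable
    rw [this.map_eq, variance_fun_id_gaussianReal] at h2
    exact h2.symm
  · exact IndepFun.covariance_eq_zero ((iIndepFun_pi (μ := fun _ : ι => gaussianReal 0 1)
      (X := fun _ => id) (fun _ => aemeasurable_id)).indepFun h) (hL i) (hL j)

lemma mvGaussian_mean {ι : Type*} [Fintype ι] (μ : ι → ℝ) (A : Matrix ι ι ℝ) (p : ι) :
    ∫ x, x p ∂(mvGaussian μ A) = μ p := by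
  have hL : ∀ i, Integrable (fun z : ι → ℝ => z i) (Measure.pi fun _ : ι => gaussianReal 0 1) :=
    fun i => (pi_hasGaussianLaw.eval i).integrable
  rw [mvGaussian, integral_map (f := fun x : ι → ℝ => x p) (by fun_prop)
    (measurable_pi_apply p).aestronglyMeasurable]
  simp only [Pi.add_apply, Matrix.mulVec, dotProduct]
  rw [integral_add (by fun_prop) (integrable_finsetSum _ fun i _ => (hL i).const_mul _),
    integral_finsetSum _ fun i _ => (hL i).const_mul _]
  simp [integral_const_mul, pi_mean]

lemma mvGaussian_cov {ι : Type*} [Fintype ι] (μ : ι → ℝ) (A : Matrix ι ι ℝ) (p q : ι) :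
    cov[fun x => x p, fun x => x q; mvGaussian μ A] = (A * Aᵀ) p q := by
  classical
  have hL : ∀ i, MemLp (fun z : ι → ℝ => z i) 2 (Measure.pi fun _ : ι => gaussianReal 0 1) :=
    fun i => (pi_hasGaussianLaw.eval i).memLp_two
  rw [mvGaussian, covariance_map_fun (measurable_pi_apply p).aestronglyMeasurable
    (measurable_pi_apply q).aestronglyMeasurable (by fun_prop)]
  simp only [Pi.add_apply, Matrix.mulVec, dotProduct]
  have hI : ∀ p, Integrable (fun z : ι → ℝ => ∑ i, A p i * z i)
      (Measure.pi fun _ : ι => gaussianReal 0 1) := fun p =>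
    integrable_finsetSum _ fun i _ => ((hL i).integrable (by norm_num)).const_mul _
  rw [covariance_const_add_left (hI p), covariance_const_add_right (hI q),
    covariance_fun_sum_fun_sum (fun i => (hL i).const_mul _) (fun i => (hL i).const_mul _)]
  simp [covariance_const_mul_left, covariance_const_mul_right, pi_cov, Matrix.mul_apply, mul_comm]

/-- The Rao–Blackwellizable split-sample estimator with data-dependent weights is
unbiased: E[Σᵢ ŵᵢ(ξ − ζ)·β̂_U((ξ + ζ)(i), 2Σ(i))] = β. -/
theorem stmt14 {Ω : Type*} [MeasurableSpace Ω] (P : Measure Ω) [IsProbabilityMeasure P]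
    (k : ℕ) (β : ℝ) (π : Fin k → ℝ) (hπ : ∀ i, 0 < π i)
    (A : Matrix (Fin 2 × Fin k) (Fin 2 × Fin k) ℝ) (hA : (A * Aᵀ).PosDef)
    (ξ ζ : Ω → (Fin 2 × Fin k) → ℝ) (hmξ : Measurable ξ) (hmζ : Measurable ζ)
    (hind : IndepFun ξ ζ P)
    (hξ : P.map ξ = mvGaussian (fun p => if p.1 = 0 then β * π p.2 else π p.2) A)
    (hζ : P.map ζ = mvGaussian 0 A)
    (w : ((Fin 2 × Fin k) → ℝ) → Fin k → ℝ) (hw : Measurable w)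
    (hwb : ∃ C : ℝ, ∀ x i, |w x i| ≤ C) (hws : ∀ x, ∑ i, w x i = 1) :
    ∫ ω, ∑ i, w (ξ ω - ζ ω) i *
        betaU ((ξ ω + ζ ω) (0, i)) ((ξ ω + ζ ω) (1, i))
          (2 * (A * Aᵀ) (0, i) (1, i)) (2 * (A * Aᵀ) (1, i) (1, i)) ∂P = β := by
  obtain ⟨C, hC⟩ := hwb
  have hGξ : HasGaussianLaw ξ P := ⟨by rw [hξ]; infer_instance⟩
  have hGζ : HasGaussianLaw ζ P := ⟨by rw [hζ]; infer_instance⟩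
  have hJ := hind.hasGaussianLaw hGξ hGζ
  have hLξ : ∀ p, MemLp (fun ω => ξ ω p) 2 P := fun p =>
    (HasGaussianLaw.eval (X := fun p ω => ξ ω p) hGξ p).memLp_two
  have hLζ : ∀ p, MemLp (fun ω => ζ ω p) 2 P := fun p =>
    (HasGaussianLaw.eval (X := fun p ω => ζ ω p) hGζ p).memLp_two
  have hcξ : ∀ p q, cov[fun ω => ξ ω p, fun ω => ξ ω q; P] = (A * Aᵀ) p q := by
    intro p q
    rw [← mvGaussian_cov _ A p q, ← hξ, covariance_map_fun
      (measurable_pi_apply p).aestronglyMeasurable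
      (measurable_pi_apply q).aestronglyMeasurable hmξ.aemeasurable]
  have hcζ : ∀ p q, cov[fun ω => ζ ω p, fun ω => ζ ω q; P] = (A * Aᵀ) p q := by
    intro p q
    rw [← mvGaussian_cov 0 A p q, ← hζ, covariance_map_fun
      (measurable_pi_apply p).aestronglyMeasurable
      (measurable_pi_apply q).aestronglyMeasurable hmζ.aemeasurable]
  have hcξζ : ∀ p q, cov[fun ω => ξ ω p, fun ω => ζ ω q; P] = 0 := fun p q =>
    IndepFun.covariance_eq_zero (hind.comp (measurable_pi_apply p) (measurable_pi_apply q))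
      (hLξ p) (hLζ q)
  have hcζξ : ∀ p q, cov[fun ω => ζ ω p, fun ω => ξ ω q; P] = 0 := fun p q => by
    rw [covariance_comm]; exact hcξζ q p
  have hmeanξ : ∀ p, ∫ ω, ξ ω p ∂P = if p.1 = 0 then β * π p.2 else π p.2 := by
    intro p
    rw [← mvGaussian_mean (fun p => if p.1 = 0 then β * π p.2 else π p.2) A p, ← hξ,
      integral_map (f := fun x : Fin 2 × Fin k → ℝ => x p) hmξ.aemeasurable (measurable_pi_apply p).aestronglyMeasurable]
  have hmeanζ : ∀ p, ∫ ω, ζ ω p ∂P = 0 := by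
    intro p
    have := mvGaussian_mean 0 A p
    rwa [← hζ, integral_map (f := fun x : Fin 2 × Fin k → ℝ => x p) hmζ.aemeasurable (measurable_pi_apply p).aestronglyMeasurable] at this
  have hLa : ∀ p, MemLp (fun ω => ξ ω p + ζ ω p) 2 P := fun p => (hLξ p).add (hLζ p)
  have hmeana : ∀ p, ∫ ω, (ξ ω p + ζ ω p) ∂P = if p.1 = 0 then β * π p.2 else π p.2 := by
    intro p
    rw [integral_add ((hLξ p).integrable (by norm_num)) ((hLζ p).integrable (by norm_num)),
      hmeanξ, hmeanζ, add_zero]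
  have hca : ∀ p q, cov[fun ω => ξ ω p + ζ ω p, fun ω => ξ ω q + ζ ω q; P]
      = 2 * (A * Aᵀ) p q := by
    intro p q
    have h1 := covariance_add_left (hLξ p) (hLζ p) (hLa q)
    have h2 := covariance_add_right (hLξ p) (hLξ q) (hLζ q)
    have h3 := covariance_add_right (hLζ p) (hLξ q) (hLζ q)
    rw [hcξ, hcξζ] at h2
    rw [hcζ, hcζξ] at h3
    refine h1.trans ?_
    refine (congrArg₂ (· + ·) h2 h3).trans ?_
    ring
  have hcab : ∀ p q, cov[fun ω => ξ ω p + ζ ω p, fun ω => ξ ω q - ζ ω q; P] = 0 := by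
    intro p q
    have h1 := covariance_add_left (hLξ p) (hLζ p) ((hLξ q).sub (hLζ q))
    have h2 := covariance_sub_right (hLξ p) (hLξ q) (hLζ q)
    have h3 := covariance_sub_right (hLζ p) (hLξ q) (hLζ q)
    rw [hcξ, hcξζ] at h2
    rw [hcζ, hcζξ] at h3
    refine h1.trans ?_
    refine (congrArg₂ (· + ·) h2 h3).trans ?_
    ring
  have hGab : HasGaussianLaw (fun ω => (fun p => ξ ω p + ζ ω p, fun p => ξ ω p - ζ ω p)) P :=
    hJ.map_fun (ContinuousLinearMap.prod
      (ContinuousLinearMap.fst ℝ (Fin 2 × Fin k → ℝ) (Fin 2 × Fin k → ℝ)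
        + ContinuousLinearMap.snd ℝ (Fin 2 × Fin k → ℝ) (Fin 2 × Fin k → ℝ))
      (ContinuousLinearMap.fst ℝ (Fin 2 × Fin k → ℝ) (Fin 2 × Fin k → ℝ)
        - ContinuousLinearMap.snd ℝ (Fin 2 × Fin k → ℝ) (Fin 2 × Fin k → ℝ)))
  have hGa : HasGaussianLaw (fun ω p => ξ ω p + ζ ω p) P := hGab.fst
  have hiab : IndepFun (fun ω p => ξ ω p + ζ ω p) (fun ω p => ξ ω p - ζ ω p) P :=
    HasGaussianLaw.indepFun_of_covariance_eval (X := fun p ω => ξ ω p + ζ ω p)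
      (Y := fun p ω => ξ ω p - ζ ω p) hGab hcab
  -- each single-instrument estimator is integrable and unbiased
  have hB : ∀ i, Integrable (fun ω => betaU ((ξ ω + ζ ω) (0, i)) ((ξ ω + ζ ω) (1, i))
          (2 * (A * Aᵀ) (0, i) (1, i)) (2 * (A * Aᵀ) (1, i) (1, i))) P ∧
      ∫ ω, betaU ((ξ ω + ζ ω) (0, i)) ((ξ ω + ζ ω) (1, i))
          (2 * (A * Aᵀ) (0, i) (1, i)) (2 * (A * Aᵀ) (1, i) (1, i)) ∂P = β := by
    intro i
    have hs : 0 < 2 * (A * Aᵀ) (1, i) (1, i) := by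
      have := hA.diag_pos (i := ((1 : Fin 2), i))
      linarith
    set s := 2 * (A * Aᵀ) (1, i) (1, i) with hsdef
    set c := 2 * (A * Aᵀ) (0, i) (1, i) / s with hc
    have hσ : 0 < Real.sqrt s := Real.sqrt_pos.2 hs
    let V : Ω → ℝ := fun ω => ξ ω (1, i) + ζ ω (1, i)
    let U : Ω → ℝ := fun ω => (ξ ω (0, i) + ζ ω (0, i)) - c * V ω
    have hGV : HasGaussianLaw V P :=
      HasGaussianLaw.eval (X := fun p ω => ξ ω p + ζ ω p) hGa (1, i)
    have hGUV : HasGaussianLaw (fun ω => (U ω, V ω)) P :=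
      hGa.map_fun ((ContinuousLinearMap.proj (R := ℝ) (φ := fun _ : Fin 2 × Fin k => ℝ) (0, i)
        - c • ContinuousLinearMap.proj (R := ℝ) (φ := fun _ : Fin 2 × Fin k => ℝ) (1, i)).prod
        (ContinuousLinearMap.proj (R := ℝ) (φ := fun _ : Fin 2 × Fin k => ℝ) (1, i)))
    have hiUV : IndepFun U V P := by
      apply hGUV.indepFun_of_covariance_eq_zero
      have h1 := covariance_fun_sub_left (hLa (0, i)) ((hLa (1, i)).const_mul c) (hLa (1, i))
      rw [covariance_const_mul_left, hca, hca] at h1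
      refine h1.trans ?_
      rw [← hsdef, hc]
      field_simp
      ring
    have hVlaw : P.map V = gaussianReal (π i) ((Real.sqrt s) ^ 2).toNNReal := by
      rw [hGV.map_eq_gaussianReal, Real.sq_sqrt hs.le]
      congr 1
      · exact (hmeana (1, i)).trans (by simp)
      · rw [← covariance_self hGV.aemeasurable]
        congr 1
        exact hca (1, i) (1, i)
    have hUi : Integrable U P := hGUV.fst.integrable
    have hUm : ∫ ω, U ω ∂P = β * π i - c * π i := by
      have h1 := (hLa (0, i)).integrable (by norm_num : (1 : ENNReal) ≤ 2)
      have h2 := (hLa (1, i)).integrable (by norm_num : (1 : ENNReal) ≤ 2)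
      refine (integral_sub h1 (h2.const_mul c)).trans ?_
      rw [integral_const_mul, hmeana, hmeana]
      simp
    have hτi : Integrable (fun ω => millsTau (Real.sqrt s) (V ω)) P := by
      have := integrable_millsTau hσ (hπ i)
      rw [← hVlaw] at this
      exact this.comp_aemeasurable hGV.aemeasurable
    have hτm : ∫ ω, millsTau (Real.sqrt s) (V ω) ∂P = 1 / π i := by
      rw [← integral_millsTau hσ (hπ i), ← hVlaw, integral_map hGV.aemeasurable
        (measurable_millsTau _).aestronglyMeasurable]
    have hiτU : IndepFun (fun ω => millsTau (Real.sqrt s) (V ω)) U P :=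
      (hiUV.symm.comp (measurable_millsTau (Real.sqrt s)) measurable_id)
    have hprod : Integrable (fun ω => millsTau (Real.sqrt s) (V ω) * U ω) P :=
      hiτU.integrable_mul hτi hUi
    have heq : (fun ω => betaU ((ξ ω + ζ ω) (0, i)) ((ξ ω + ζ ω) (1, i))
          (2 * (A * Aᵀ) (0, i) (1, i)) s) = fun ω => millsTau (Real.sqrt s) (V ω) * U ω + c := rfl
    rw [heq]
    refine ⟨hprod.add (integrable_const c), ?_⟩
    rw [integral_add hprod (integrable_const c),
      hiτU.integral_fun_mul_eq_mul_integral hτi.aestronglyMeasurable hUi.aestronglyMeasurable,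
      hτm, hUm]
    have := (hπ i).ne'
    simp
    field_simp
    ring
  have hwm : ∀ i, Measurable fun x => w x i := fun i => (measurable_pi_apply i).comp hw
  have hWm : ∀ i, Measurable fun ω => w (ξ ω - ζ ω) i := fun i => (hwm i).comp (hmξ.sub hmζ)
  have hWi : ∀ i, Integrable (fun ω => w (ξ ω - ζ ω) i) P := fun i =>
    Integrable.of_bound (hWm i).aestronglyMeasurable C (ae_of_all _ fun ω => hC _ i)
  have hbm : ∀ i, Measurable fun x : Fin 2 × Fin k → ℝ => betaU (x (0, i)) (x (1, i))
          (2 * (A * Aᵀ) (0, i) (1, i)) (2 * (A * Aᵀ) (1, i) (1, i)) := by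
    intro i
    unfold betaU
    exact (((measurable_millsTau _).comp (measurable_pi_apply (1, i))).mul
      ((measurable_pi_apply (0, i)).sub ((measurable_pi_apply (1, i)).const_mul _))).add_const _
  have hI : ∀ i, IndepFun (fun ω => w (ξ ω - ζ ω) i)
      (fun ω => betaU ((ξ ω + ζ ω) (0, i)) ((ξ ω + ζ ω) (1, i))
          (2 * (A * Aᵀ) (0, i) (1, i)) (2 * (A * Aᵀ) (1, i) (1, i))) P := fun i =>
    hiab.symm.comp (hwm i) (hbm i)
  refine (integral_finsetSum _ fun i _ => (hI i).integrable_mul (hWi i) (hB i).1).trans ?_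
  simp only [Pi.mul_apply]
  have hterm : ∀ i, ∫ ω, w (ξ ω - ζ ω) i * betaU ((ξ ω + ζ ω) (0, i)) ((ξ ω + ζ ω) (1, i))
          (2 * (A * Aᵀ) (0, i) (1, i)) (2 * (A * Aᵀ) (1, i) (1, i)) ∂P
      = (∫ ω, w (ξ ω - ζ ω) i ∂P) * β := by
    intro i
    rw [(hI i).integral_fun_mul_eq_mul_integral (hWi i).aestronglyMeasurable
      (hB i).1.aestronglyMeasurable, (hB i).2]
  simp_rw [hterm]
  rw [← Finset.sum_mul, ← integral_finsetSum _ fun i _ => hWi i]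
  simp [hws]
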